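/- Let Φ be a growth function that is differentiable on (0,∞), with Φ(t) > 0 for all t > 0, and such that t ↦ t·Φ'(t) is nondecreasing on (0,∞). Then Φ satisfies the Δ_{1/2}-condition if and only if a_Φ = inf_{t>0} t·Φ'(t)/Φ(t) > 0. -/

import Mathlib

/-- For a growth function `Φ` (continuous, nondecreasing, mapping `[0,∞)`
onto itself), positive on `(0,∞)`, differentiable on `(0,∞)`, with `t ↦ t·Φ'(t)`
nondecreasing on `(0,∞)`, the `Δ_{1/2}`-condition holds iff
`a_Φ = inf_{t>0} t·Φ'(t)/Φ(t) > 0`. -/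
theorem stmt_2 (Φ : ℝ → ℝ)
    (hcont : ContinuousOn Φ (Set.Ici 0))
    (hmono : MonotoneOn Φ (Set.Ici 0))
    (hmaps : Set.MapsTo Φ (Set.Ici 0) (Set.Ici 0))
    (hsurj : Set.SurjOn Φ (Set.Ici 0) (Set.Ici 0))
    (hdiff : ∀ t : ℝ, 0 < t → DifferentiableAt ℝ Φ t)
    (hpos : ∀ t : ℝ, 0 < t → 0 < Φ t)
    (hmono' : MonotoneOn (fun t => t * deriv Φ t) (Set.Ioi 0)) :
    (∃ K : ℝ, 0 < K ∧ K < 1 ∧ ∀ t : ℝ, 0 ≤ t → Φ (t / 2) ≤ K * Φ t) ↔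
      0 < sInf {x : ℝ | ∃ t : ℝ, 0 < t ∧ x = t * deriv Φ t / Φ t} := by
  have h0 : Φ 0 = 0 := by
    obtain ⟨s, hs, hs0⟩ := hsurj (show (0:ℝ) ∈ Set.Ici 0 by simp)
    rcases (show (0:ℝ) ≤ s from hs).eq_or_lt with h | h
    · subst h; exact hs0
    · exact absurd hs0 (hpos s h).ne'
  have mvt : ∀ t : ℝ, 0 < t → ∃ c, t / 2 < c ∧ c < t ∧ Φ t - Φ (t / 2) = deriv Φ c * (t / 2) := by
    intro t ht
    obtain ⟨c, hc, h⟩ := exists_deriv_eq_slope Φ (show t / 2 < t by linarith)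
      (hcont.mono (fun x hx => by
        have := hx.1
        simp only [Set.mem_Ici]; linarith))
      (fun x hx => (hdiff x (by linarith [hx.1])).differentiableWithinAt)
    refine ⟨c, hc.1, hc.2, ?_⟩
    have h2 : t - t / 2 = t / 2 := by ring
    rw [h, h2]
    field_simp
  constructor
  · rintro ⟨K, hK0, hK1, hK⟩
    have hle : 1 - K ≤ sInf {x : ℝ | ∃ t : ℝ, 0 < t ∧ x = t * deriv Φ t / Φ t} := by
      refine le_csInf ⟨_, 1, one_pos, rfl⟩ ?_
      rintro x ⟨t, ht, rfl⟩
      obtain ⟨c, hc1, hc2, hc⟩ := mvt t ht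
      have hc0 : 0 < c := by linarith
      have hp := hpos t ht
      have hm : c * deriv Φ c ≤ t * deriv Φ t := hmono' hc0 ht hc2.le
      have hk := hK t ht.le
      rw [le_div_iff₀ hp]
      have hd : 0 < deriv Φ c := by
        have : 0 < deriv Φ c * (t / 2) := by nlinarith
        exact pos_of_mul_pos_left this (by linarith)
      nlinarith
    linarith
  · intro ha
    set a := sInf {x : ℝ | ∃ t : ℝ, 0 < t ∧ x = t * deriv Φ t / Φ t} with hadef
    have hb : BddBelow {x : ℝ | ∃ t : ℝ, 0 < t ∧ x = t * deriv Φ t / Φ t} := by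
      by_contra hb
      rw [Real.sInf_of_not_bddBelow hb] at hadef
      linarith
    have hal : ∀ t : ℝ, 0 < t → a * Φ t ≤ t * deriv Φ t := by
      intro t ht
      rw [← le_div_iff₀ (hpos t ht)]
      exact csInf_le hb ⟨t, ht, rfl⟩
    refine ⟨1 / (1 + a / 2), by positivity, ?_, ?_⟩
    · rw [div_lt_one (by positivity)]; linarith
    · intro t ht
      rcases ht.eq_or_lt with h | h
      · simp [← h, h0]
      · obtain ⟨c, hc1, hc2, hc⟩ := mvt t h
        have hc0 : 0 < c := by linarith
        have h1 := hal c hc0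
        have h2 : Φ (t / 2) ≤ Φ c :=
          hmono (show (0:ℝ) ≤ t / 2 by linarith) hc0.le hc1.le
        have hd : 0 < deriv Φ c := by
          have : 0 < c * deriv Φ c := lt_of_lt_of_le (mul_pos ha (hpos c hc0)) h1
          exact pos_of_mul_pos_right this hc0.le
        have h3 : a * Φ (t / 2) ≤ a * Φ c := mul_le_mul_of_nonneg_left h2 ha.le
        have h4 : c * deriv Φ c ≤ t * deriv Φ c := mul_le_mul_of_nonneg_right hc2.le hd.le
        rw [one_div, inv_mul_eq_div, le_div_iff₀ (by positivity)]
        nlinarith
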